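/- arXiv:1312.2380 — 2 statements merged into one kernel-verified Lean document; each statement's English description precedes it below -/
import Mathlib

section
/- Let E be a real inner product space and let φ : [0,∞) → (0,∞) be a strictly positive function such that t ↦ t·φ(t) is strictly increasing on [0,∞). Define a : E → E by a(ξ) = φ(‖ξ‖)·ξ. Then a is strictly monotone: for all ξ, η ∈ E with ξ ≠ η one has ⟨a(ξ) − a(η), ξ − η⟩ > 0. -/
open scoped RealInnerProductSpace

/-- Strict monotonicity of a radial vector field `a(ξ) = φ(‖ξ‖) ξ` on a real
inner product space, when `φ` is strictly positive on `[0,∞)` and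
`t ↦ t·φ(t)` is strictly increasing on `[0,∞)`. -/
theorem radial_strict_monotone {E : Type*} [NormedAddCommGroup E] [InnerProductSpace ℝ E]
    (φ : ℝ → ℝ) (hφ0 : ∀ t : ℝ, 0 ≤ t → 0 < φ t)
    (hmono : ∀ s t : ℝ, 0 ≤ s → s < t → s * φ s < t * φ t)
    (ξ η : E) (hne : ξ ≠ η) :
    0 < ⟪φ ‖ξ‖ • ξ - φ ‖η‖ • η, ξ - η⟫ := by
  rcases eq_or_ne ‖ξ‖ ‖η‖ with h | h
  · rw [h, ← smul_sub, real_inner_smul_left]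
    exact mul_pos (hφ0 _ (norm_nonneg _)) (real_inner_self_pos.2 (sub_ne_zero.2 hne))
  · have expand : ⟪φ ‖ξ‖ • ξ - φ ‖η‖ • η, ξ - η⟫ =
        (‖ξ‖ * φ ‖ξ‖ - ‖η‖ * φ ‖η‖) * (‖ξ‖ - ‖η‖) +
          (φ ‖ξ‖ + φ ‖η‖) * (‖ξ‖ * ‖η‖ - ⟪ξ, η⟫) := by
      simp only [inner_sub_left, inner_sub_right, real_inner_smul_left,
        real_inner_self_eq_norm_sq, real_inner_comm ξ η]
      ring
    have radial : 0 < (‖ξ‖ * φ ‖ξ‖ - ‖η‖ * φ ‖η‖) * (‖ξ‖ - ‖η‖) := by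
      rcases h.lt_or_gt with hlt | hlt
      · exact mul_pos_of_neg_of_neg (sub_neg.2 (hmono _ _ (norm_nonneg _) hlt)) (sub_neg.2 hlt)
      · exact mul_pos (sub_pos.2 (hmono _ _ (norm_nonneg _) hlt)) (sub_pos.2 hlt)
    have angular : 0 ≤ (φ ‖ξ‖ + φ ‖η‖) * (‖ξ‖ * ‖η‖ - ⟪ξ, η⟫) :=
      mul_nonneg (add_pos (hφ0 _ (norm_nonneg _)) (hφ0 _ (norm_nonneg _))).le
        (sub_nonneg.2 (real_inner_le_norm ξ η))
    rw [expand]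
    exact add_pos_of_pos_of_nonneg radial angular
end

section
/- Fix d ≥ 1 and p > 1. Define S_p : ℝ^{d×d} → ℝ^{d×d} by S_p(ξ) = (1+|ξ|)^{p−2} ξ, where |·| is the Frobenius norm. Then S_p is strictly monotone: for all matrices ξ ≠ η one has ⟨S_p(ξ) − S_p(η), ξ − η⟩ > 0, where ⟨·,·⟩ is the Frobenius inner product. -/
open scoped RealInnerProductSpace

/-- For `p > 1` the scalar function `t ↦ (1+t)^(p-2) t` is strictly increasing on `[0, ∞)`. -/
lemma strictMonoOn_one_add_rpow_mul {p : ℝ} (hp : 1 < p) :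
    StrictMonoOn (fun t : ℝ => (1 + t) ^ (p - 2) * t) (Set.Ici 0) := by
  have key : ∀ t : ℝ, 0 ≤ t → (1 + t) ^ (p - 2) * t = (1 + t) ^ (p - 1) * (t / (1 + t)) := by
    intro t ht
    have h : 0 < 1 + t := by linarith
    rw [show p - 2 = (p - 1) - 1 by ring, Real.rpow_sub_one h.ne']
    ring
  intro a ha b hb hab
  rw [Set.mem_Ici] at ha hb
  have ha' : 0 < 1 + a := by linarith
  have hb' : 0 < 1 + b := by linarith
  change (1 + a) ^ (p - 2) * a < (1 + b) ^ (p - 2) * b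
  rw [key a ha, key b hb]
  have hpow : (1 + a) ^ (p - 1) ≤ (1 + b) ^ (p - 1) :=
    Real.rpow_le_rpow ha'.le (by linarith) (by linarith)
  have hdiv : a / (1 + a) < b / (1 + b) := by
    rw [div_lt_div_iff₀ ha' hb']
    linarith
  exact mul_lt_mul' hpow hdiv (by positivity) (by positivity)

/-- A radial map `x ↦ w(‖x‖) x` on a real inner product space, with `w` positive and
`t ↦ w(t) t` strictly increasing on `[0, ∞)`, is strictly monotone. -/
lemma inner_radial_sub_pos {E : Type*} [NormedAddCommGroup E] [InnerProductSpace ℝ E]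
    {w : ℝ → ℝ} (hw : ∀ t, 0 ≤ t → 0 < w t)
    (hmono : StrictMonoOn (fun t => w t * t) (Set.Ici 0)) {x y : E} (hne : x ≠ y) :
    0 < ⟪w ‖x‖ • x - w ‖y‖ • y, x - y⟫ := by
  have expand : ⟪w ‖x‖ • x - w ‖y‖ • y, x - y⟫ =
      (w ‖x‖ * ‖x‖ - w ‖y‖ * ‖y‖) * (‖x‖ - ‖y‖) +
        (w ‖x‖ + w ‖y‖) * (‖x‖ * ‖y‖ - ⟪x, y⟫) := by
    simp only [inner_sub_left, inner_sub_right, real_inner_smul_left,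
      real_inner_self_eq_norm_sq, real_inner_comm x y]
    ring
  have hsum : 0 < w ‖x‖ + w ‖y‖ := add_pos (hw _ (norm_nonneg x)) (hw _ (norm_nonneg y))
  have hangle : 0 ≤ (w ‖x‖ + w ‖y‖) * (‖x‖ * ‖y‖ - ⟪x, y⟫) :=
    mul_nonneg hsum.le (sub_nonneg.2 (real_inner_le_norm x y))
  rw [expand]
  rcases lt_trichotomy ‖x‖ ‖y‖ with h | h | h
  · have := hmono (norm_nonneg x) (norm_nonneg y) h
    exact add_pos_of_pos_of_nonneg
      (mul_pos_of_neg_of_neg (sub_neg.2 this) (sub_neg.2 h)) hangle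
  · have hpos : 0 < ‖x - y‖ ^ 2 := pow_pos (norm_pos_iff.2 (sub_ne_zero.2 hne)) 2
    rw [norm_sub_sq_real, h] at hpos
    rw [h] at hsum ⊢
    have : 0 < ‖y‖ * ‖y‖ - ⟪x, y⟫ := by nlinarith
    simpa using mul_pos hsum this
  · have := hmono (norm_nonneg y) (norm_nonneg x) h
    exact add_pos_of_pos_of_nonneg (mul_pos (sub_pos.2 this) (sub_pos.2 h)) hangle

/-- The power-law stress `S_p(ξ) = (1+|ξ|)^(p-2) ξ` on `d×d` matrices with the
Frobenius inner product (realized as the Euclidean space indexed by pairs of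
indices) is strictly monotone. -/
theorem powerLaw_stress_strict_monotone (d : ℕ) (hd : 1 ≤ d) (p : ℝ) (hp : 1 < p)
    (ξ η : EuclideanSpace ℝ (Fin d × Fin d)) (hne : ξ ≠ η) :
    0 < ⟪(1 + ‖ξ‖) ^ (p - 2) • ξ - (1 + ‖η‖) ^ (p - 2) • η, ξ - η⟫ := by
  exact inner_radial_sub_pos (w := fun t => (1 + t) ^ (p - 2))
    (fun t ht => Real.rpow_pos_of_pos (by linarith) _) (strictMonoOn_one_add_rpow_mul hp) hne
end
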